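/- arXiv:2011.05222 — 2 statements merged into one kernel-verified Lean document; each statement's English description precedes it below -/
import Mathlib

section
/- Let μ̄ ∈ ℝ and set μ̂ := μ̄ − T^{−1/𝔯}·C_h. If μ̂ > 0, then for all real t ≥ s ≥ 0 one has −μ̄·(t−s) + ∫_s^t |h(τ)| dτ ≤ −(μ̂/2)·(t−s) + (1/𝔯)·((𝔯−1)/𝔯)^{𝔯−1}·C_h^𝔯·(μ̂/2)^{1−𝔯}; consequently exp(−μ̄(t−s) + ∫_s^t |h(τ)| dτ) ≤ exp( (1/𝔯)·((𝔯−1)/𝔯)^{𝔯−1}·C_h^𝔯·(μ̂/2)^{1−𝔯} )·e^{−(μ̂/2)(t−s)} for all t ≥ s ≥ 0. -/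
open MeasureTheory

/-- Linearized Young inequality with the optimal constant. -/
theorem le_add_const_mul_rpow {r ε x : ℝ} (hr : 1 < r) (hε : 0 < ε) (hx : 0 ≤ x) :
    x ≤ ε + (1 / r) * ((r - 1) / r) ^ (r - 1) * ε ^ (1 - r) * x ^ r := by
  have hr0 : 0 < r := by linarith
  have hr1 : 0 < r - 1 := by linarith
  have hc : 0 < (r - 1) / r := by positivity
  have hy : 0 ≤ (r - 1) / r / ε * x := by positivity
  have hB := one_add_mul_self_le_rpow_one_add (s := (r - 1) / r / ε * x - 1)
    (by linarith) hr.le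
  rw [add_sub_cancel, Real.mul_rpow (by positivity) hx, Real.div_rpow hc.le hε.le] at hB
  have hB' := mul_le_mul_of_nonneg_left hB (by positivity : 0 ≤ ε / (r - 1))
  have hl : ε / (r - 1) * (1 + r * ((r - 1) / r / ε * x - 1)) = x - ε := by
    field_simp
    ring
  have hrhs : ε / (r - 1) * (((r - 1) / r) ^ r / ε ^ r * x ^ r) =
      (1 / r) * ((r - 1) / r) ^ (r - 1) * ε ^ (1 - r) * x ^ r := by
    rw [Real.rpow_sub hε, Real.rpow_one, Real.rpow_sub_one hc.ne']
    field_simp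
  rw [hl, hrhs] at hB'
  linarith

/-- Over a whole period the optimal choice of the parameter in `le_add_const_mul_rpow` gives
Hölder's constant. -/
theorem young_const_eq_holder_const {T C r : ℝ} (hT : 0 < T) (hC : 0 < C) (hr : 1 < r) :
    (r - 1) / r * (T ^ (-1 / r) * C) * T + (1 / r) * ((r - 1) / r) ^ (r - 1) *
      ((r - 1) / r * (T ^ (-1 / r) * C)) ^ (1 - r) * C ^ r = T ^ (-1 / r) * C * T := by
  have hr0 : 0 < r := by linarith
  have hr1 : 0 < r - 1 := by linarith
  have hc : 0 < (r - 1) / r := by positivity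
  have hTr : 0 < T ^ (-1 / r) := by positivity
  have hTT : (T ^ (-1 / r)) ^ r = T⁻¹ := by
    rw [← Real.rpow_mul hT.le, div_mul_cancel₀ _ hr0.ne', Real.rpow_neg_one]
  have hcc : ((r - 1) / r) ^ (r - 1) * ((r - 1) / r) ^ (1 - r) = 1 := by
    rw [← Real.rpow_add hc]
    simp
  have hD : (T ^ (-1 / r) * C) ^ (1 - r) * C ^ r = T ^ (-1 / r) * C * T := by
    rw [Real.rpow_sub (by positivity), Real.rpow_one, Real.mul_rpow hTr.le hC.le, hTT]
    have : 0 < C ^ r := by positivity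
    field_simp
  calc _ = (r - 1) / r * (T ^ (-1 / r) * C * T) + (1 / r) *
        (((r - 1) / r) ^ (r - 1) * ((r - 1) / r) ^ (1 - r)) *
        ((T ^ (-1 / r) * C) ^ (1 - r) * C ^ r) := by
        rw [Real.mul_rpow hc.le (by positivity : 0 ≤ T ^ (-1 / r) * C)]
        ring
    _ = _ := by
        rw [hcc, hD]
        field_simp
        ring

/-- A measurable function is integrable where its `r`-th power is, `r > 1`. -/
theorem intervalIntegrable_abs_of_rpow {r a b : ℝ} {h : ℝ → ℝ} (hr : 1 < r)
    (hmeas : Measurable h) (hi : IntervalIntegrable (fun τ => |h τ| ^ r) volume a b) :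
    IntervalIntegrable (fun τ => |h τ|) volume a b := by
  refine ((intervalIntegrable_const (c := (1 : ℝ))).add (hi.const_mul
    ((1 / r) * ((r - 1) / r) ^ (r - 1) * 1 ^ (1 - r)))).mono_fun
    hmeas.abs.aestronglyMeasurable (Filter.Eventually.of_forall fun τ => ?_)
  have := le_add_const_mul_rpow hr one_pos (abs_nonneg (h τ))
  simp only [Real.norm_eq_abs, abs_abs]
  exact this.trans (le_abs_self _)

/-- Integrated form of `le_add_const_mul_rpow`. -/
theorem integral_abs_le_add_const_mul {r ε a b : ℝ} {h : ℝ → ℝ} (hr : 1 < r) (hε : 0 < ε)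
    (hab : a ≤ b) (hmeas : Measurable h)
    (hi : IntervalIntegrable (fun τ => |h τ| ^ r) volume a b) :
    (∫ τ in a..b, |h τ|) ≤ ε * (b - a) +
      (1 / r) * ((r - 1) / r) ^ (r - 1) * ε ^ (1 - r) * ∫ τ in a..b, |h τ| ^ r := by
  have hi' := hi.const_mul ((1 / r) * ((r - 1) / r) ^ (r - 1) * ε ^ (1 - r))
  calc (∫ τ in a..b, |h τ|)
      ≤ ∫ τ in a..b, (ε + (1 / r) * ((r - 1) / r) ^ (r - 1) * ε ^ (1 - r) * |h τ| ^ r) :=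
        intervalIntegral.integral_mono_on hab (intervalIntegrable_abs_of_rpow hr hmeas hi)
          (intervalIntegrable_const.add hi')
          fun τ _ => le_add_const_mul_rpow hr hε (abs_nonneg _)
    _ = _ := by
        rw [intervalIntegral.integral_add intervalIntegrable_const hi',
          intervalIntegral.integral_const, intervalIntegral.integral_const_mul, smul_eq_mul,
          mul_comm (b - a)]

/-- A function with uniformly bounded `L^r` norms on windows of length `T` has integrals of at
most linear growth, with rate arbitrarily close to `T ^ (-1 / r) * C`. -/
theorem integral_abs_le_linear_add_const {T C r a : ℝ} (hT : 0 < T) (hC : 0 < C) (hr : 1 < r)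
    (ha : 0 < a) {h : ℝ → ℝ} (hmeas : Measurable h)
    (hloc : ∀ a b : ℝ, 0 ≤ a → IntegrableOn (fun τ => |h τ| ^ r) (Set.Icc a b))
    (hbound : ∀ s : ℝ, 0 ≤ s → (∫ τ in s..(s + T), |h τ| ^ r) ≤ C ^ r)
    {s t : ℝ} (hs : 0 ≤ s) (hst : s ≤ t) :
    (∫ τ in s..t, |h τ|) ≤ (T ^ (-1 / r) * C + a) * (t - s) +
      (1 / r) * ((r - 1) / r) ^ (r - 1) * a ^ (1 - r) * C ^ r := by
  have hr0 : 0 < r := by linarith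
  have hr1 : 0 < r - 1 := by linarith
  have hint : ∀ u v : ℝ, 0 ≤ u → u ≤ v →
      IntervalIntegrable (fun τ => |h τ| ^ r) volume u v := fun u v hu huv =>
    (intervalIntegrable_iff_integrableOn_Icc_of_le huv).2 (hloc u v hu)
  have key : ∀ n : ℕ, ∀ s : ℝ, 0 ≤ s → s ≤ t → t ≤ s + n * T →
      (∫ τ in s..t, |h τ|) ≤ (T ^ (-1 / r) * C + a) * (t - s) +
        (1 / r) * ((r - 1) / r) ^ (r - 1) * a ^ (1 - r) * C ^ r := by
    intro n
    induction n with
    | zero =>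
      intro s hs hst htn
      obtain rfl : s = t := by
        simp only [Nat.cast_zero, zero_mul, add_zero] at htn
        exact le_antisymm hst htn
      rw [intervalIntegral.integral_same, sub_self, mul_zero, zero_add]
      positivity
    | succ n ih =>
      intro s hs hst htn
      push_cast at htn
      rcases le_total t (s + T) with htT | htT
      · have hy := integral_abs_le_add_const_mul hr ha hst hmeas (hint s t hs hst)
        have hm : (∫ τ in s..t, |h τ| ^ r) ≤ C ^ r := by
          refine le_trans ?_ (hbound s hs)
          exact intervalIntegral.integral_mono_interval le_rfl hst htT
            (Filter.Eventually.of_forall fun τ => by positivity)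
            (hint s (s + T) hs (by linarith))
        have hk := mul_le_mul_of_nonneg_left hm
          (by positivity : 0 ≤ (1 / r) * ((r - 1) / r) ^ (r - 1) * a ^ (1 - r))
        have hn : 0 ≤ T ^ (-1 / r) * C * (t - s) :=
          mul_nonneg (by positivity) (by linarith)
        linarith
      · have hsT : s ≤ s + T := by linarith
        have hε : 0 < (r - 1) / r * (T ^ (-1 / r) * C) := by positivity
        have hy := integral_abs_le_add_const_mul hr hε hsT hmeas (hint s (s + T) hs hsT)
        have hk := mul_le_mul_of_nonneg_left (hbound s hs)
          (by positivity : 0 ≤ (1 / r) * ((r - 1) / r) ^ (r - 1) *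
            ((r - 1) / r * (T ^ (-1 / r) * C)) ^ (1 - r))
        have hE := young_const_eq_holder_const hT hC hr
        have hI := ih (s + T) (by linarith) htT (by linarith)
        have haT : 0 < a * T := by positivity
        rw [add_sub_cancel_left] at hy
        rw [← intervalIntegral.integral_add_adjacent_intervals
          (intervalIntegrable_abs_of_rpow hr hmeas (hint s (s + T) hs hsT))
          (intervalIntegrable_abs_of_rpow hr hmeas (hint (s + T) t (by linarith) htT))]
        linarith
  obtain ⟨n, hn⟩ := exists_nat_ge ((t - s) / T)
  rw [div_le_iff₀ hT] at hn
  exact key n s hs hst (by linarith)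

/-- With `μ̂ := μ̄ - T^(-1/r) C_h > 0`, for all `t ≥ s ≥ 0`,
`-μ̄(t-s) + ∫_s^t |h| ≤ -(μ̂/2)(t-s) + (1/r)((r-1)/r)^(r-1) C_h^r (μ̂/2)^(1-r)`, and hence
`exp(-μ̄(t-s) + ∫_s^t |h|) ≤ exp((1/r)((r-1)/r)^(r-1) C_h^r (μ̂/2)^(1-r)) e^{-(μ̂/2)(t-s)}`. -/
theorem stmt_2 (T Ch r : ℝ) (hT : 0 < T) (hCh : 0 < Ch) (hr : 1 < r)
    (h : ℝ → ℝ) (hmeas : Measurable h)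
    (hloc : ∀ a b : ℝ, 0 ≤ a → IntegrableOn (fun τ => |h τ| ^ r) (Set.Icc a b))
    (hbound : ∀ s : ℝ, 0 ≤ s → (∫ τ in s..(s + T), |h τ| ^ r) ≤ Ch ^ r)
    (μbar : ℝ) (hμhat : 0 < μbar - T ^ (-1 / r) * Ch) :
    ∀ s t : ℝ, 0 ≤ s → s ≤ t →
      (-μbar * (t - s) + ∫ τ in s..t, |h τ|) ≤
          -((μbar - T ^ (-1 / r) * Ch) / 2) * (t - s) +
            (1 / r) * ((r - 1) / r) ^ (r - 1) * Ch ^ r *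
              ((μbar - T ^ (-1 / r) * Ch) / 2) ^ (1 - r) ∧
      Real.exp (-μbar * (t - s) + ∫ τ in s..t, |h τ|) ≤
        Real.exp ((1 / r) * ((r - 1) / r) ^ (r - 1) * Ch ^ r *
            ((μbar - T ^ (-1 / r) * Ch) / 2) ^ (1 - r)) *
          Real.exp (-((μbar - T ^ (-1 / r) * Ch) / 2) * (t - s)) := by
  intro s t hs hst
  have hgrowth := integral_abs_le_linear_add_const hT hCh hr (half_pos hμhat) hmeas hloc hbound
    hs hst
  refine ⟨by linarith, ?_⟩
  rw [← Real.exp_add]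
  exact Real.exp_le_exp.2 (by linarith)
end

section
/- Let μ > 0 and p > 0 be real numbers. Then for every t ≥ 0 one has ∫_0^t e^{−μpτ}·|h(τ)| dτ ≤ (μp)^{(1−𝔯)/𝔯}·C_h·(1 − e^{−μpT})^{−1/𝔯}. -/
open MeasureTheory

/-- A function that is integrable on bounded subintervals of `[0, ∞)` stays interval integrable
after multiplication by an exponential weight. -/
lemma intervalIntegrable_exp_mul {g : ℝ → ℝ}
    (hg : ∀ a b : ℝ, 0 ≤ a → IntegrableOn g (Set.Icc a b)) (c : ℝ) {a b : ℝ}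
    (ha : 0 ≤ a) (hab : a ≤ b) :
    IntervalIntegrable (fun τ => Real.exp (-c * τ) * g τ) volume a b := by
  have hgab : IntervalIntegrable g volume a b :=
    (intervalIntegrable_iff_integrableOn_Icc_of_le hab).2 (hg a b ha)
  exact hgab.continuousOn_mul (by fun_prop)

/-- If the integrals of `g ≥ 0` over windows of length `T` are at most `M`, then its
exponentially weighted integral over `n` consecutive windows is at most a geometric sum. -/
lemma integral_exp_mul_le_geom_sum {g : ℝ → ℝ} {T M c : ℝ} (hT : 0 ≤ T) (hc : 0 ≤ c)
    (hg0 : ∀ τ, 0 ≤ g τ) (hg : ∀ a b : ℝ, 0 ≤ a → IntegrableOn g (Set.Icc a b))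
    (hbound : ∀ s : ℝ, 0 ≤ s → (∫ τ in s..(s + T), g τ) ≤ M) (n : ℕ) :
    (∫ τ in (0 : ℝ)..(n * T), Real.exp (-c * τ) * g τ) ≤
      M * ∑ k ∈ Finset.range n, Real.exp (-c * T) ^ k := by
  induction n with
  | zero => simp
  | succ n ih =>
    have hn : 0 ≤ n * T := by positivity
    have hle : (n : ℝ) * T ≤ n * T + T := by linarith
    have hwindow : (∫ τ in (n * T)..(n * T + T), Real.exp (-c * τ) * g τ) ≤
        M * Real.exp (-c * T) ^ n := by
      calc (∫ τ in (n * T)..(n * T + T), Real.exp (-c * τ) * g τ)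
          ≤ ∫ τ in (n * T)..(n * T + T), Real.exp (-c * T) ^ n * g τ := by
            refine intervalIntegral.integral_mono_on hle
              (intervalIntegrable_exp_mul hg c hn hle)
              (((intervalIntegrable_iff_integrableOn_Icc_of_le hle).2
                (hg _ _ hn)).const_mul _) fun τ hτ => ?_
            refine mul_le_mul_of_nonneg_right ?_ (hg0 τ)
            rw [← Real.exp_nat_mul]
            exact Real.exp_le_exp.2 (by nlinarith [mul_le_mul_of_nonneg_left hτ.1 hc])
        _ = Real.exp (-c * T) ^ n * ∫ τ in (n * T)..(n * T + T), g τ :=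
            intervalIntegral.integral_const_mul _ _
        _ ≤ M * Real.exp (-c * T) ^ n := by
            rw [mul_comm]
            exact mul_le_mul_of_nonneg_right (hbound _ hn) (by positivity)
    have hsucc : ((n + 1 : ℕ) : ℝ) * T = n * T + T := by push_cast; ring
    rw [hsucc, Finset.sum_range_succ, mul_add,
      ← intervalIntegral.integral_add_adjacent_intervals
        (intervalIntegrable_exp_mul hg c le_rfl hn) (intervalIntegrable_exp_mul hg c hn hle)]
    exact add_le_add ih hwindow

/-- If the integrals of `g ≥ 0` over windows of length `T` are at most `M`, then
`∫_0^t e^{-cτ} g(τ) dτ ≤ M / (1 - e^{-cT})`. -/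
lemma integral_exp_mul_le_of_window_bound {g : ℝ → ℝ} {T M c : ℝ} (hT : 0 < T) (hc : 0 < c)
    (hM : 0 ≤ M) (hg0 : ∀ τ, 0 ≤ g τ)
    (hg : ∀ a b : ℝ, 0 ≤ a → IntegrableOn g (Set.Icc a b))
    (hbound : ∀ s : ℝ, 0 ≤ s → (∫ τ in s..(s + T), g τ) ≤ M) {t : ℝ} (ht : 0 ≤ t) :
    (∫ τ in (0 : ℝ)..t, Real.exp (-c * τ) * g τ) ≤ M * (1 - Real.exp (-c * T))⁻¹ := by
  obtain ⟨n, hn⟩ := exists_nat_ge (t / T)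
  have htn : t ≤ n * T := (div_le_iff₀ hT).1 hn
  have hx1 : Real.exp (-c * T) < 1 := Real.exp_lt_one_iff.2 (by nlinarith [mul_pos hc hT])
  calc (∫ τ in (0 : ℝ)..t, Real.exp (-c * τ) * g τ)
      ≤ ∫ τ in (0 : ℝ)..(n * T), Real.exp (-c * τ) * g τ :=
        intervalIntegral.integral_mono_interval le_rfl ht htn
          (Filter.Eventually.of_forall fun τ => mul_nonneg (Real.exp_pos _).le (hg0 τ))
          (intervalIntegrable_exp_mul hg c le_rfl (ht.trans htn))
    _ ≤ M * ∑ k ∈ Finset.range n, Real.exp (-c * T) ^ k :=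
        integral_exp_mul_le_geom_sum hT.le hc.le hg0 hg hbound n
    _ ≤ M * (1 - Real.exp (-c * T))⁻¹ := by
        refine mul_le_mul_of_nonneg_left ?_ hM
        rw [← tsum_geometric_of_lt_one (Real.exp_pos _).le hx1]
        exact (summable_geometric_of_lt_one (Real.exp_pos _).le hx1).sum_le_tsum _
          fun k _ => by positivity

/-- `∫_0^t e^{-cτ} dτ ≤ 1 / c`. -/
lemma integral_exp_neg_mul_le_inv {c : ℝ} (hc : 0 < c) (t : ℝ) :
    (∫ τ in (0 : ℝ)..t, Real.exp (-c * τ)) ≤ c⁻¹ := by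
  have hne : -c ≠ 0 := by linarith
  rw [intervalIntegral.integral_comp_mul_left (fun x => Real.exp x) hne, integral_exp,
    smul_eq_mul, mul_zero, Real.exp_zero, inv_neg]
  nlinarith [mul_pos (inv_pos.2 hc) (Real.exp_pos (-c * t))]

/-- Hölder's inequality with respect to the weight `e^{-cτ}` on `[0, t]`. -/
lemma integral_exp_mul_abs_le_holder {h : ℝ → ℝ} {q r : ℝ} (hqr : q.HolderConjugate r)
    (hmeas : Measurable h)
    (hloc : ∀ a b : ℝ, 0 ≤ a → IntegrableOn (fun τ => |h τ| ^ r) (Set.Icc a b))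
    (c : ℝ) {t : ℝ} (ht : 0 ≤ t) :
    (∫ τ in (0 : ℝ)..t, Real.exp (-c * τ) * |h τ|) ≤
      (∫ τ in (0 : ℝ)..t, Real.exp (-c * τ)) ^ (1 / q) *
        (∫ τ in (0 : ℝ)..t, Real.exp (-c * τ) * |h τ| ^ r) ^ (1 / r) := by
  have hq := hqr.pos
  have hr := hqr.symm.pos
  have hpow : ∀ {s : ℝ}, 0 < s → ∀ τ, Real.exp (-c * τ / s) ^ s = Real.exp (-c * τ) := by
    intro s hs τ
    rw [← Real.exp_mul, div_mul_cancel₀ _ hs.ne']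
  have hpow' : ∀ τ, (Real.exp (-c * τ / r) * |h τ|) ^ r = Real.exp (-c * τ) * |h τ| ^ r := by
    intro τ
    rw [Real.mul_rpow (Real.exp_pos _).le (abs_nonneg _), hpow hr]
  have hsplit : ∀ τ, Real.exp (-c * τ) * |h τ| =
      Real.exp (-c * τ / q) * (Real.exp (-c * τ / r) * |h τ|) := by
    intro τ
    rw [← mul_assoc, ← Real.exp_add, div_eq_mul_inv, div_eq_mul_inv, ← mul_add,
      hqr.inv_add_inv_eq_one, mul_one]
  have hf : MemLp (fun τ => Real.exp (-c * τ / q)) (ENNReal.ofReal q)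
      (volume.restrict (Set.Ioc 0 t)) := by
    rw [← integrable_norm_rpow_iff (by fun_prop) (by simpa using hq) ENNReal.ofReal_ne_top,
      ENNReal.toReal_ofReal hq.le]
    simp only [Real.norm_eq_abs, Real.abs_exp, hpow hq]
    exact (Continuous.integrableOn_Ioc (by fun_prop))
  have hg : MemLp (fun τ => Real.exp (-c * τ / r) * |h τ|) (ENNReal.ofReal r)
      (volume.restrict (Set.Ioc 0 t)) := by
    rw [← integrable_norm_rpow_iff (by fun_prop) (by simpa using hr) ENNReal.ofReal_ne_top,
      ENNReal.toReal_ofReal hr.le]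
    simp only [norm_mul, Real.norm_eq_abs, Real.abs_exp, abs_abs, hpow']
    exact (intervalIntegrable_iff_integrableOn_Ioc_of_le ht).1
      (intervalIntegrable_exp_mul hloc c le_rfl ht)
  have key := integral_mul_le_Lp_mul_Lq_of_nonneg hqr
    (Filter.Eventually.of_forall fun τ => (Real.exp_pos _).le)
    (Filter.Eventually.of_forall fun τ => mul_nonneg (Real.exp_pos _).le (abs_nonneg _)) hf hg
  simp only [hpow hq, hpow', ← hsplit] at key
  simpa only [intervalIntegral.integral_of_le ht] using key

/-- For `μ > 0` and `p > 0`, for every `t ≥ 0`,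
`∫_0^t e^{-μ p τ} |h(τ)| dτ ≤ (μ p)^((1-r)/r) C_h (1 - e^{-μ p T})^(-1/r)`. -/
theorem stmt_5 (T Ch r : ℝ) (hT : 0 < T) (hCh : 0 < Ch) (hr : 1 < r)
    (h : ℝ → ℝ) (hmeas : Measurable h)
    (hloc : ∀ a b : ℝ, 0 ≤ a → IntegrableOn (fun τ => |h τ| ^ r) (Set.Icc a b))
    (hbound : ∀ s : ℝ, 0 ≤ s → (∫ τ in s..(s + T), |h τ| ^ r) ≤ Ch ^ r)
    (μ p : ℝ) (hμ : 0 < μ) (hp : 0 < p) :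
    ∀ t : ℝ, 0 ≤ t →
      (∫ τ in (0:ℝ)..t, Real.exp (-μ * p * τ) * |h τ|) ≤
        (μ * p) ^ ((1 - r) / r) * Ch * (1 - Real.exp (-μ * p * T)) ^ (-1 / r) := by
  intro t ht
  have hr0 : 0 < r := by linarith
  have hc : 0 < μ * p := mul_pos hμ hp
  have hqr : r.conjExponent.HolderConjugate r := (Real.HolderConjugate.conjExponent hr).symm
  have hx : 0 < 1 - Real.exp (-(μ * p) * T) :=
    sub_pos.2 (Real.exp_lt_one_iff.2 (by nlinarith [mul_pos hc hT]))
  have hexp : 1 / r.conjExponent = -((1 - r) / r) := by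
    rw [one_div, ← hqr.symm.one_sub_inv]
    field_simp
    ring
  rw [neg_mul μ p]
  calc (∫ τ in (0 : ℝ)..t, Real.exp (-(μ * p) * τ) * |h τ|)
      ≤ (∫ τ in (0 : ℝ)..t, Real.exp (-(μ * p) * τ)) ^ (1 / r.conjExponent) *
        (∫ τ in (0 : ℝ)..t, Real.exp (-(μ * p) * τ) * |h τ| ^ r) ^ (1 / r) :=
        integral_exp_mul_abs_le_holder hqr hmeas hloc (μ * p) ht
    _ ≤ (μ * p)⁻¹ ^ (1 / r.conjExponent) *
        (Ch ^ r * (1 - Real.exp (-(μ * p) * T))⁻¹) ^ (1 / r) := by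
        have hq := hqr.one_div_nonneg
        refine mul_le_mul
          (Real.rpow_le_rpow (intervalIntegral.integral_nonneg ht fun τ _ => (Real.exp_pos _).le)
            (integral_exp_neg_mul_le_inv hc t) hq)
          (Real.rpow_le_rpow (intervalIntegral.integral_nonneg ht fun τ _ => by positivity)
            (integral_exp_mul_le_of_window_bound hT hc (by positivity)
              (fun τ => by positivity) hloc hbound ht) (by positivity))
          (Real.rpow_nonneg (intervalIntegral.integral_nonneg ht fun τ _ => by positivity) _)
          (by positivity)
    _ = (μ * p) ^ ((1 - r) / r) * Ch * (1 - Real.exp (-(μ * p) * T)) ^ (-1 / r) := by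
        rw [hexp, Real.inv_rpow hc.le, Real.rpow_neg hc.le, inv_inv,
          Real.mul_rpow (by positivity) (inv_nonneg.2 hx.le), ← Real.rpow_mul hCh.le,
          mul_one_div_cancel hr0.ne', Real.rpow_one, Real.inv_rpow hx.le, neg_div,
          Real.rpow_neg hx.le, mul_assoc]
end
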